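/- arXiv:1102.4421 — 2 statements merged into one kernel-verified Lean document; each statement's English description precedes it below -/
import Mathlib

section
/- Assume Hypothesis (⋆). Let p be a prime, (x,y) an arc, E_x = ⟨O_p(G_{x,z}) : z ∈ Δ(x)⟩ and E_y = ⟨O_p(G_{z,y}) : z ∈ Δ(y)⟩. If E_x ⊄ G_x^{[1]} and E_y ⊄ G_y^{[1]}, then G_{x,y}^{[1]} is a p-group. -/
open Equiv Subgroup

/-- `N` (a subgroup of `Perm V`) acts transitively on the neighbourhood of `x`. -/
def transOn {V : Type*} (Δ : SimpleGraph V) (N : Subgroup (Equiv.Perm V)) (x : V) : Prop :=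
  ∀ u ∈ Δ.neighborSet x, ∀ v ∈ Δ.neighborSet x, ∃ g ∈ N, g u = v

/-- The permutation group induced by `N` on the neighbourhood of `x` is semiregular. -/
def semiregOn {V : Type*} (Δ : SimpleGraph V) (N : Subgroup (Equiv.Perm V)) (x : V) : Prop :=
  ∀ g ∈ N, (∃ u ∈ Δ.neighborSet x, g u = u) → ∀ v ∈ Δ.neighborSet x, g v = v

/-- The stabiliser `G_x`. -/
def vstab {V : Type*} (G : Subgroup (Equiv.Perm V)) (x : V) : Subgroup (Equiv.Perm V) :=
  G ⊓ MulAction.stabilizer (Equiv.Perm V) x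

/-- `G_x^{[i]}`: pointwise stabiliser of the ball of radius `i` around `x`. -/
def ball {V : Type*} (Δ : SimpleGraph V) (G : Subgroup (Equiv.Perm V)) (x : V) (i : ℕ) :
    Subgroup (Equiv.Perm V) :=
  G ⊓ ⨅ z ∈ {z : V | Δ.dist x z ≤ i}, MulAction.stabilizer (Equiv.Perm V) z

/-- `K` is a normal subgroup of `H` (both subgroups of `Perm V`). -/
def normalIn {V : Type*} (K H : Subgroup (Equiv.Perm V)) : Prop :=
  K ≤ H ∧ ∀ h ∈ H, ∀ k ∈ K, h * k * h⁻¹ ∈ K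

/-- `O_p(H)`: the largest normal `p`-subgroup of `H`. -/
def Op {V : Type*} (p : ℕ) (H : Subgroup (Equiv.Perm V)) : Subgroup (Equiv.Perm V) :=
  sSup {K | normalIn K H ∧ IsPGroup p K}

/-- `E_x = ⟨O_p(G_{x,z}) : z ∈ Δ(x)⟩`. -/
def Ep {V : Type*} (Δ : SimpleGraph V) (G : Subgroup (Equiv.Perm V)) (p : ℕ) (x : V) :
    Subgroup (Equiv.Perm V) :=
  ⨆ z ∈ Δ.neighborSet x, Op p (vstab G x ⊓ vstab G z)

/-- `C_{G_x}(G_x^{[1]})`. -/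
def locCent {V : Type*} (Δ : SimpleGraph V) (G : Subgroup (Equiv.Perm V)) (x : V) :
    Subgroup (Equiv.Perm V) :=
  vstab G x ⊓ Subgroup.centralizer ((ball Δ G x 1 : Subgroup (Equiv.Perm V)) : Set (Equiv.Perm V))

/-- Hypothesis (⋆). -/
def StarHyp {V : Type*} (Δ : SimpleGraph V) (G : Subgroup (Equiv.Perm V)) : Prop :=
  ∀ x : V,
    transOn Δ (vstab G x) x ∧
    (transOn Δ (locCent Δ G x) x ∨ semiregOn Δ (locCent Δ G x) x) ∧
    ∀ p : ℕ, p.Prime → (transOn Δ (Ep Δ G p x) x ∨ semiregOn Δ (Ep Δ G p x) x)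

/-- `G` is a group of automorphisms of `Δ`. -/
def isAut {V : Type*} (Δ : SimpleGraph V) (G : Subgroup (Equiv.Perm V)) : Prop :=
  ∀ g ∈ G, ∀ u v : V, Δ.Adj (g u) (g v) ↔ Δ.Adj u v

/-- `K` is a subnormal subgroup of `H`. -/
def subnormalIn {V : Type*} (K H : Subgroup (Equiv.Perm V)) : Prop :=
  ∃ (n : ℕ) (c : ℕ → Subgroup (Equiv.Perm V)),
    c 0 = K ∧ c n = H ∧ ∀ i < n, normalIn (c i) (c (i + 1))

/-- `K` is quasisimple: perfect and simple modulo its centre. -/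
def IsQuasisimple {V : Type*} (K : Subgroup (Equiv.Perm V)) : Prop :=
  commutator ↥K = ⊤ ∧ IsSimpleGroup (↥K ⧸ Subgroup.center ↥K)

/-- `E(H)`: the layer, generated by the components of `H`. -/
def layer {V : Type*} (H : Subgroup (Equiv.Perm V)) : Subgroup (Equiv.Perm V) :=
  sSup {K | subnormalIn K H ∧ IsQuasisimple K}

/-- `F(H)`: the Fitting subgroup of `H`. -/
def fitting {V : Type*} (H : Subgroup (Equiv.Perm V)) : Subgroup (Equiv.Perm V) :=
  sSup {K | normalIn K H ∧ Group.IsNilpotent ↥K}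

/-- `F*(H) = E(H)F(H)`: the generalised Fitting subgroup of `H`. -/
def genFitting {V : Type*} (H : Subgroup (Equiv.Perm V)) : Subgroup (Equiv.Perm V) :=
  layer H ⊔ fitting H

theorem aux_isPGroup_Op {V : Type*} (p : ℕ) (H : Subgroup (Equiv.Perm V)) :
    IsPGroup p (Op p H) := by
  have h1 : IsPGroup p (sSup {K : Subgroup H | K.Normal ∧ IsPGroup p K} : Subgroup H) :=
    Sylow.sSup_of_normal _ (fun K hK => hK.2) (fun K hK => hK.1)
  refine (h1.map H.subtype).to_le ?_
  refine sSup_le ?_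
  rintro K ⟨⟨hle, hn⟩, hK⟩
  have h2 : K.subgroupOf H ≤ sSup {K : Subgroup H | K.Normal ∧ IsPGroup p K} := by
    refine le_sSup ⟨⟨?_⟩, hK.comap_subtype⟩
    intro k hk g
    exact hn g g.2 k hk
  intro k hk
  exact ⟨⟨k, hle hk⟩, h2 hk, rfl⟩

theorem aux_Op_le {V : Type*} (p : ℕ) (H : Subgroup (Equiv.Perm V)) : Op p H ≤ H :=
  sSup_le fun _ hK => hK.1.1

theorem aux_Op_conj {V : Type*} (p : ℕ) (H : Subgroup (Equiv.Perm V)) {h k : Equiv.Perm V}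
    (hh : h ∈ H) (hk : k ∈ Op p H) : h * k * h⁻¹ ∈ Op p H := by
  have : Op p H ≤ (Op p H).comap (MulAut.conj h).toMonoidHom := by
    refine sSup_le fun K hK k hk => ?_
    have h3 : K ≤ Op p H := le_sSup hK
    exact h3 (hK.1.2 h hh k hk)
  exact this hk

theorem aux_mem_ball {V : Type*} {Δ : SimpleGraph V} (hconn : Δ.Connected)
    {G : Subgroup (Equiv.Perm V)} {x : V} {g : Equiv.Perm V} :
    g ∈ ball Δ G x 1 ↔ g ∈ G ∧ g x = x ∧ ∀ z, Δ.Adj x z → g z = z := by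
  simp only [ball, Subgroup.mem_inf, Subgroup.mem_iInf, MulAction.mem_stabilizer_iff,
    Set.mem_ofPred_eq, Equiv.Perm.smul_def]
  constructor
  · rintro ⟨h1, h2⟩
    exact ⟨h1, h2 x (by simp), fun z hz => h2 z (SimpleGraph.dist_eq_one_iff_adj.2 hz).le⟩
  · rintro ⟨h1, h2, h3⟩
    refine ⟨h1, fun z hz => ?_⟩
    rcases Nat.le_one_iff_eq_zero_or_eq_one.1 hz with h | h
    · rw [← hconn.dist_eq_zero_iff.1 h]; exact h2
    · exact h3 z (SimpleGraph.dist_eq_one_iff_adj.1 h)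

theorem aux_mem_vstab {V : Type*} {G : Subgroup (Equiv.Perm V)} {x : V} {g : Equiv.Perm V} :
    g ∈ vstab G x ↔ g ∈ G ∧ g x = x := by
  simp [vstab, Subgroup.mem_inf, MulAction.mem_stabilizer_iff]

theorem aux_ball_conj {V : Type*} {Δ : SimpleGraph V} (hconn : Δ.Connected)
    {G : Subgroup (Equiv.Perm V)} (hG : isAut Δ G) {x : V} {g k : Equiv.Perm V}
    (hg : g ∈ vstab G x) (hk : k ∈ ball Δ G x 1) : g * k * g⁻¹ ∈ ball Δ G x 1 := by
  rw [aux_mem_ball hconn] at *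
  rw [aux_mem_vstab] at hg
  have hx : g⁻¹ x = x := by rw [Equiv.Perm.inv_eq_iff_eq]; exact hg.2.symm
  refine ⟨mul_mem (mul_mem hg.1 hk.1) (inv_mem hg.1), ?_, fun z hz => ?_⟩
  · simp [Equiv.Perm.mul_apply, hx, hk.2.1, hg.2]
  · have : Δ.Adj x (g⁻¹ z) := by
      rw [← hG g hg.1, hg.2]; simpa using hz
    rw [Equiv.Perm.mul_apply, Equiv.Perm.mul_apply, hk.2.2 _ this]
    simp

/-- Subgroup generated by the `p'`-elements of `A`. -/
def auxK {V : Type*} (p : ℕ) (A : Subgroup (Equiv.Perm V)) : Subgroup (Equiv.Perm V) :=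
  Subgroup.closure {k | k ∈ A ∧ ∃ n : ℕ, n.Coprime p ∧ k ^ n = 1}

theorem auxK_le {V : Type*} (p : ℕ) (A : Subgroup (Equiv.Perm V)) : auxK p A ≤ A :=
  (Subgroup.closure_le _).2 fun _ h => h.1

/-- It suffices to conjugate generators. -/
theorem auxK_conj {V : Type*} {p : ℕ} {A : Subgroup (Equiv.Perm V)} {g : Equiv.Perm V}
    (h : ∀ k ∈ A, (∃ n : ℕ, n.Coprime p ∧ k ^ n = 1) → g * k * g⁻¹ ∈ auxK p A)
    {k : Equiv.Perm V} (hk : k ∈ auxK p A) : g * k * g⁻¹ ∈ auxK p A := by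
  have : auxK p A ≤ (auxK p A).comap (MulAut.conj g).toMonoidHom :=
    (Subgroup.closure_le _).2 fun k hk => h k hk.1 hk.2
  exact this hk

theorem aux_conj_pow {M : Type*} [Group M] (g k : M) (n : ℕ) (h : k ^ n = 1) :
    (g * k * g⁻¹) ^ n = 1 := by
  rw [conj_pow, h]; simp

theorem auxK_norm {V : Type*} {p : ℕ} {A : Subgroup (Equiv.Perm V)} {g : Equiv.Perm V}
    (h : ∀ k ∈ A, g * k * g⁻¹ ∈ A)
    {k : Equiv.Perm V} (hk : k ∈ auxK p A) : g * k * g⁻¹ ∈ auxK p A := by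
  refine auxK_conj (fun k hk hn => ?_) hk
  obtain ⟨n, hn, hkn⟩ := hn
  exact Subgroup.subset_closure ⟨h k hk, n, hn, aux_conj_pow _ _ _ hkn⟩

/-- If `q` normalises `K`, then `(q k)^j ∈ q^j K`. -/
theorem aux_pow {M : Type*} [Group M] (K : Subgroup M) {q k : M}
    (hq : q⁻¹ ∈ Subgroup.normalizer (K : Set M)) (hk : k ∈ K) (j : ℕ) :
    (q ^ j)⁻¹ * (q * k) ^ j ∈ K := by
  induction j with
  | zero => simp
  | succ j ih =>
    have h1 := (Subgroup.mem_normalizer_iff.1 hq _).1 ih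
    have : (q ^ (j+1))⁻¹ * (q * k) ^ (j+1) =
        (q⁻¹ * ((q ^ j)⁻¹ * (q * k) ^ j) * q⁻¹⁻¹) * k := by
      rw [pow_succ, pow_succ]; group
    rw [this]
    exact mul_mem h1 hk

theorem aux_Ep_norm {V : Type*} [Finite V] {Δ : SimpleGraph V} {G : Subgroup (Equiv.Perm V)}
    (hconn : Δ.Connected) (hG : isAut Δ G) {p : ℕ} {x y : V} (hxy : Δ.Adj x y) :
    Ep Δ G p x ≤ G ⊓ Subgroup.normalizer
      (auxK p (ball Δ G x 1 ⊓ ball Δ G y 1) : Set (Equiv.Perm V)) := by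
  refine iSup₂_le fun z hz e he => ?_
  have hz : Δ.Adj x z := hz
  have he' := aux_Op_le _ _ he
  have hex : e ∈ vstab G x := he'.1
  refine ⟨(aux_mem_vstab.1 hex).1, ?_⟩
  set A := ball Δ G x 1 ⊓ ball Δ G y 1 with hA
  refine Subgroup.mem_normalizer_fintype fun k hk => ?_
  refine auxK_conj (fun k hk hn => ?_) hk
  have hkK : k ∈ auxK p A := Subgroup.subset_closure ⟨hk, hn⟩
  obtain ⟨n, hn, hkn⟩ := hn
  have hkx := (aux_mem_ball hconn).1 hk.1
  have hkst : k ∈ vstab G x ⊓ vstab G z :=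
    ⟨aux_mem_vstab.2 ⟨hkx.1, hkx.2.1⟩, aux_mem_vstab.2 ⟨hkx.1, hkx.2.2 z hz⟩⟩
  -- the commutator
  set q := e * k * e⁻¹ * k⁻¹ with hq
  have hqO : q ∈ Op p (vstab G x ⊓ vstab G z) := by
    have := mul_mem he (aux_Op_conj p _ hkst (inv_mem he))
    have h2 : q = e * (k * e⁻¹ * k⁻¹) := by rw [hq]; group
    rw [h2]; exact this
  have hqB : q ∈ ball Δ G x 1 := mul_mem (aux_ball_conj hconn hG hex hk.1) (inv_mem hk.1)
  have hqi : q⁻¹ ∈ Subgroup.normalizer (auxK p A : Set (Equiv.Perm V)) := by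
    refine Subgroup.mem_normalizer_fintype fun k hk => auxK_norm (fun k hk => ?_) hk
    have hqi := (aux_mem_ball hconn).1 (inv_mem hqB)
    exact ⟨aux_ball_conj hconn hG (aux_mem_vstab.2 ⟨hqi.1, hqi.2.1⟩) hk.1,
      aux_ball_conj hconn hG (aux_mem_vstab.2 ⟨hqi.1, hqi.2.2 y hxy⟩) hk.2⟩
  obtain ⟨m, hm⟩ := isPGroup_iff_pow_pow_eq_one.1 (aux_isPGroup_Op p _) ⟨q, hqO⟩
  have hm : q ^ p ^ m = 1 := by simpa using congrArg Subtype.val hm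
  have h1 := aux_pow (auxK p A) hqi hkK (p ^ m)
  have h2 : q * k = e * k * e⁻¹ := by rw [hq]; group
  rw [hm, h2] at h1
  have h3 : (e * k * e⁻¹) ^ (p ^ m) ∈ auxK p A := by simpa using h1
  have h4 : (e * k * e⁻¹) ^ n = 1 := aux_conj_pow _ _ _ hkn
  have h5 : IsCoprime ((p ^ m : ℕ) : ℤ) (n : ℤ) :=
    Nat.isCoprime_iff_coprime.2 (hn.symm.pow_left m)
  obtain ⟨a, b, hab⟩ := h5
  have h6 : e * k * e⁻¹ = ((e * k * e⁻¹) ^ (p ^ m)) ^ a * ((e * k * e⁻¹) ^ n) ^ b := by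
    rw [← zpow_natCast, ← zpow_natCast, ← zpow_mul, ← zpow_mul, ← zpow_add,
      mul_comm _ a, mul_comm _ b, hab, zpow_one]
  rw [h6, h4, one_zpow, mul_one]
  exact zpow_mem h3 a

theorem aux_trans {V : Type*} {Δ : SimpleGraph V} {G : Subgroup (Equiv.Perm V)}
    (hconn : Δ.Connected) (hstar : StarHyp Δ G)
    {p : ℕ} (hp : p.Prime) {x : V} (hEx : ¬ Ep Δ G p x ≤ ball Δ G x 1) :
    transOn Δ (Ep Δ G p x) x := by
  rcases (hstar x).2.2 p hp with h | h
  · exact h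
  · refine absurd (iSup₂_le fun z hz e he => ?_) hEx
    have he' := aux_Op_le _ _ he
    have heE : e ∈ Ep Δ G p x := (le_iSup₂_of_le z hz le_rfl : _ ≤ Ep Δ G p x) he
    have h1 := aux_mem_vstab.1 he'.1
    have h2 := aux_mem_vstab.1 he'.2
    exact (aux_mem_ball hconn).2 ⟨h1.1, h1.2, fun v hv => h e heE ⟨z, hz, h2.2⟩ v hv⟩

theorem stmt8 {V : Type*} [Fintype V] (Δ : SimpleGraph V) (G : Subgroup (Equiv.Perm V))
    (hconn : Δ.Connected) (hG : isAut Δ G) (hstar : StarHyp Δ G)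
    (p : ℕ) (hp : p.Prime) {x y : V} (hxy : Δ.Adj x y)
    (hEx : ¬ Ep Δ G p x ≤ ball Δ G x 1) (hEy : ¬ Ep Δ G p y ≤ ball Δ G y 1) :
    IsPGroup p ↥(ball Δ G x 1 ⊓ ball Δ G y 1) := by
  have hNx := aux_Ep_norm (p := p) hconn hG hxy
  have hNy := aux_Ep_norm (p := p) hconn hG hxy.symm
  rw [inf_comm (ball Δ G y 1)] at hNy
  have hTx := aux_trans hconn hstar hp hEx
  have hTy := aux_trans hconn hstar hp hEy
  set A := ball Δ G x 1 ⊓ ball Δ G y 1 with hA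
  set N := G ⊓ Subgroup.normalizer (auxK p A : Set (Equiv.Perm V)) with hN
  have key : ∀ v, ∃ g ∈ N, g x = v ∨ g y = v := by
    intro v
    obtain ⟨w⟩ := hconn.preconnected v x
    refine (?_ : ∀ (a b : V) (w : Δ.Walk a b), (∃ g ∈ N, g x = b ∨ g y = b) →
      ∃ g ∈ N, g x = a ∨ g y = a) v x w ⟨1, one_mem _, by simp⟩
    intro a b w
    induction w with
    | nil => exact id
    | @cons u v b hadj _ ih =>
      intro hb
      obtain ⟨g, hg, h⟩ := ih hb
      have hadj' : Δ.Adj (g⁻¹ v) (g⁻¹ u) := by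
        rw [← hG g hg.1]; simpa using hadj.symm
      rcases h with h | h
      · have hv : g⁻¹ v = x := by rw [Equiv.Perm.inv_eq_iff_eq]; exact h.symm
        rw [hv] at hadj'
        obtain ⟨e, he, hey⟩ := hTx y hxy _ hadj'
        exact ⟨g * e, mul_mem hg (hNx he), Or.inr (by simp [Equiv.Perm.mul_apply, hey])⟩
      · have hv : g⁻¹ v = y := by rw [Equiv.Perm.inv_eq_iff_eq]; exact h.symm
        rw [hv] at hadj'
        obtain ⟨e, he, hey⟩ := hTy x hxy.symm _ hadj'
        exact ⟨g * e, mul_mem hg (hNy he), Or.inl (by simp [Equiv.Perm.mul_apply, hey])⟩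
  have hbot : ∀ k ∈ auxK p A, k = 1 := by
    intro k hk
    ext v
    obtain ⟨g, hg, h⟩ := key v
    have h1 : g⁻¹ * k * g ∈ A := auxK_le _ _ ((Subgroup.mem_normalizer_iff''.1 hg.2 k).1 hk)
    have hx1 := ((aux_mem_ball hconn).1 h1.1).2.1
    have hy1 := ((aux_mem_ball hconn).1 h1.2).2.1
    rw [Equiv.Perm.mul_apply, Equiv.Perm.mul_apply, Equiv.Perm.inv_eq_iff_eq] at hx1 hy1
    rcases h with h | h
    · rw [← h, hx1]; rfl
    · rw [← h, hy1]; rfl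
  rw [isPGroup_iff_pow_pow_eq_one]
  rintro ⟨a, ha⟩
  have ho : orderOf a ≠ 0 := (orderOf_pos a).ne'
  obtain ⟨m, n, hn, hmn⟩ := Nat.exists_eq_pow_mul_and_not_dvd ho p hp.ne_one
  refine ⟨m, Subtype.ext ?_⟩
  have h2 : a ^ p ^ m ∈ auxK p A := by
    refine Subgroup.subset_closure ⟨pow_mem ha _, n, ?_, ?_⟩
    · exact ((Nat.Prime.coprime_iff_not_dvd hp).2 hn).symm
    · rw [← pow_mul, ← hmn, pow_orderOf_eq_one]
  simpa using hbot _ h2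
end

section
/- Assume Hypothesis (⋆) and let (x,y) be an arc of Δ. Then either G_{x,y}^{[1]} is a p-group for some prime p, or (after possibly interchanging x and y) G_{x,y}^{[1]} = G_x^{[2]} and G_y^{[2]} = G_y^{[3]} is a p-group for some prime p. -/
open Equiv Subgroup

section helpers
variable {V : Type*}

theorem mem_ball' (Δ : SimpleGraph V) (G : Subgroup (Equiv.Perm V)) (x : V) (i : ℕ)
    (g : Equiv.Perm V) : g ∈ ball Δ G x i ↔ g ∈ G ∧ ∀ z, Δ.dist x z ≤ i → g z = z := by
  simp [ball, Subgroup.mem_inf, Subgroup.mem_iInf, MulAction.mem_stabilizer_iff]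

theorem mem_vstab' (G : Subgroup (Equiv.Perm V)) (x : V)
    (g : Equiv.Perm V) : g ∈ vstab G x ↔ g ∈ G ∧ g x = x := by
  simp [vstab, Subgroup.mem_inf, MulAction.mem_stabilizer_iff]

/-- automorphism attached to an element of `G` -/
def autOf {Δ : SimpleGraph V} {G : Subgroup (Equiv.Perm V)} (hG : isAut Δ G)
    (g : Equiv.Perm V) (hg : g ∈ G) : Δ ≃g Δ :=
  ⟨g, fun {a b} => hG g hg a b⟩

theorem dist_aut {Δ : SimpleGraph V} {G : Subgroup (Equiv.Perm V)} (hG : isAut Δ G)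
    (hconn : Δ.Connected) {g : Equiv.Perm V} (hg : g ∈ G) (u v : V) :
    Δ.dist (g u) (g v) = Δ.dist u v := by
  have key : ∀ g ∈ G, ∀ u v : V, Δ.dist (g u) (g v) ≤ Δ.dist u v := by
    intro g hg u v
    obtain ⟨w, hw⟩ := hconn.exists_walk_length_eq_dist u v
    rw [← hw]
    have := SimpleGraph.dist_le (w.map (autOf hG g hg).toHom)
    simpa [autOf] using this
  apply le_antisymm (key g hg u v)
  have := key g⁻¹ (G.inv_mem hg) (g u) (g v)
  simpa using this

theorem conj_ball {Δ : SimpleGraph V} {G : Subgroup (Equiv.Perm V)} (hG : isAut Δ G)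
    (hconn : Δ.Connected) {g k : Equiv.Perm V} (hg : g ∈ G) {x : V} {i : ℕ}
    (hk : k ∈ ball Δ G x i) : g * k * g⁻¹ ∈ ball Δ G (g x) i := by
  rw [mem_ball'] at hk ⊢
  refine ⟨G.mul_mem (G.mul_mem hg hk.1) (G.inv_mem hg), fun z hz => ?_⟩
  have : k (g⁻¹ z) = g⁻¹ z := by
    apply hk.2
    rw [← dist_aut hG hconn hg]
    simpa using hz
  rw [Equiv.Perm.mul_apply, Equiv.Perm.mul_apply, this]
  simp

theorem ball_anti (Δ : SimpleGraph V) (G : Subgroup (Equiv.Perm V)) (x : V) {i j : ℕ}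
    (h : i ≤ j) : ball Δ G x j ≤ ball Δ G x i := by
  intro g hg
  rw [mem_ball'] at hg ⊢
  exact ⟨hg.1, fun z hz => hg.2 z (hz.trans h)⟩

theorem ball_adj {Δ : SimpleGraph V} {G : Subgroup (Equiv.Perm V)} (hconn : Δ.Connected)
    {x y : V} (h : Δ.Adj x y) (i : ℕ) : ball Δ G x (i + 1) ≤ ball Δ G y i := by
  intro g hg
  rw [mem_ball'] at hg ⊢
  refine ⟨hg.1, fun z hz => hg.2 z ?_⟩
  have h1 := hconn.dist_triangle (u := x) (v := y) (w := z)
  have h2 : Δ.dist x y = 1 := SimpleGraph.dist_eq_one_iff_adj.2 h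
  omega

theorem ball_succ {Δ : SimpleGraph V} {G : Subgroup (Equiv.Perm V)} (hconn : Δ.Connected)
    {x y : V} (h : Δ.Adj x y) {i : ℕ} (hi : 1 ≤ i) {g : Equiv.Perm V}
    (hg : ∀ z, Δ.Adj x z → g ∈ ball Δ G z i) : g ∈ ball Δ G x (i + 1) := by
  rw [mem_ball']
  refine ⟨((mem_ball' _ _ _ _ _).1 (hg y h)).1, fun w hw => ?_⟩
  obtain ⟨p, hp⟩ := hconn.exists_walk_length_eq_dist x w
  cases p with
  | nil =>
    apply ((mem_ball' _ _ _ _ _).1 (hg y h)).2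
    rw [SimpleGraph.dist_eq_one_iff_adj.2 h.symm]
    exact hi
  | cons hadj q =>
    apply ((mem_ball' _ _ _ _ _).1 (hg _ hadj)).2
    have := SimpleGraph.dist_le q
    simp at hp
    omega

theorem ball_le_vstab {Δ : SimpleGraph V} {G : Subgroup (Equiv.Perm V)}
    (x : V) (i : ℕ) : ball Δ G x i ≤ vstab G x := by
  intro g hg
  rw [mem_ball'] at hg
  rw [mem_vstab']
  exact ⟨hg.1, hg.2 x (by simp)⟩

theorem ball_le_vstab_adj {Δ : SimpleGraph V} {G : Subgroup (Equiv.Perm V)}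
    {x z : V} (h : Δ.Adj x z) {i : ℕ} (hi : 1 ≤ i) : ball Δ G x i ≤ vstab G z := by
  intro g hg
  rw [mem_ball'] at hg
  rw [mem_vstab']
  exact ⟨hg.1, hg.2 z (by rw [SimpleGraph.dist_eq_one_iff_adj.2 h]; exact hi)⟩

theorem mem_ball_one {Δ : SimpleGraph V} {G : Subgroup (Equiv.Perm V)} (hconn : Δ.Connected)
    {x : V} {g : Equiv.Perm V} (hg : g ∈ vstab G x) (h : ∀ z, Δ.Adj x z → g z = z) :
    g ∈ ball Δ G x 1 := by
  rw [mem_vstab'] at hg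
  rw [mem_ball']
  refine ⟨hg.1, fun z hz => ?_⟩
  rcases Nat.le_one_iff_eq_zero_or_eq_one.1 hz with h0 | h1
  · rw [hconn.dist_eq_zero_iff] at h0
    rw [← h0]; exact hg.2
  · exact h z (SimpleGraph.dist_eq_one_iff_adj.1 h1)

theorem normalIn_ball {Δ : SimpleGraph V} {G : Subgroup (Equiv.Perm V)} (hG : isAut Δ G)
    (hconn : Δ.Connected) (x : V) (i : ℕ) : normalIn (ball Δ G x i) (vstab G x) := by
  refine ⟨ball_le_vstab x i, fun h hh k hk => ?_⟩
  rw [mem_vstab'] at hh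
  have := conj_ball hG hconn hh.1 hk
  rwa [hh.2] at this

theorem normalIn.mono {K H L : Subgroup (Equiv.Perm V)} (h : normalIn K H) (hL : L ≤ H)
    (hK : K ≤ L) : normalIn K L := ⟨hK, fun g hg k hk => h.2 g (hL hg) k hk⟩

theorem normalIn.inf {K K' H : Subgroup (Equiv.Perm V)} (h : normalIn K H) (h' : normalIn K' H) :
    normalIn (K ⊓ K') H :=
  ⟨inf_le_left.trans h.1, fun g hg k hk => ⟨h.2 g hg k hk.1, h'.2 g hg k hk.2⟩⟩

theorem normalIn.inv {K H : Subgroup (Equiv.Perm V)} (h : normalIn K H) {g k : Equiv.Perm V}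
    (hg : g ∈ H) (hk : k ∈ K) : g⁻¹ * k * g ∈ K := by
  simpa using h.2 g⁻¹ (H.inv_mem hg) k hk

/-- invariance set as a subgroup -/
def setNorm (S : Set (Equiv.Perm V)) : Subgroup (Equiv.Perm V) where
  carrier := {g | ∀ s, s ∈ S ↔ g * s * g⁻¹ ∈ S}
  one_mem' := by intro s; simp
  mul_mem' := by
    intro a b ha hb s
    rw [hb s, ha (b * s * b⁻¹)]
    simp [mul_assoc]
  inv_mem' := by
    intro a ha s
    rw [ha (a⁻¹ * s * a⁻¹⁻¹)]
    simp [mul_assoc]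

theorem le_setNorm {S : Set (Equiv.Perm V)} {N : Subgroup (Equiv.Perm V)}
    (h : ∀ g ∈ N, ∀ s ∈ S, g * s * g⁻¹ ∈ S) : N ≤ setNorm S := by
  intro g hg s
  refine ⟨h g hg s, fun hs => ?_⟩
  have := h g⁻¹ (N.inv_mem hg) _ hs
  simpa [mul_assoc] using this

theorem key {Δ : SimpleGraph V} {G : Subgroup (Equiv.Perm V)} (hconn : Δ.Connected)
    (hG : isAut Δ G) {x y : V} (hxy : Δ.Adj x y) (S : Set (Equiv.Perm V))
    (hSx : ∀ s ∈ S, s x = x) (hSy : ∀ s ∈ S, s y = y)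
    {Nx Ny : Subgroup (Equiv.Perm V)} (hNx : Nx ≤ vstab G x) (hNy : Ny ≤ vstab G y)
    (tx : transOn Δ Nx x) (ty : transOn Δ Ny y)
    (ix : ∀ g ∈ Nx, ∀ s ∈ S, g * s * g⁻¹ ∈ S) (iy : ∀ g ∈ Ny, ∀ s ∈ S, g * s * g⁻¹ ∈ S) :
    ∀ s ∈ S, s = 1 := by
  set L : Subgroup (Equiv.Perm V) := G ⊓ setNorm S with hL
  have hx : Nx ≤ L := le_inf (hNx.trans inf_le_left) (le_setNorm ix)
  have hy : Ny ≤ L := le_inf (hNy.trans inf_le_left) (le_setNorm iy)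
  have adjinv : ∀ g ∈ L, ∀ u v, Δ.Adj (g u) v → Δ.Adj u (g⁻¹ v) := by
    intro g hg u v h
    rw [← hG g hg.1]; simpa using h
  have step : ∀ v w, Δ.Adj v w → (∃ g ∈ L, g x = v ∨ g y = v) → (∃ g ∈ L, g x = w ∨ g y = w) := by
    rintro v w hvw ⟨g, hg, h | h⟩
    · obtain ⟨n, hn, h'⟩ := tx y hxy (g⁻¹ w) (adjinv g hg _ _ (h ▸ hvw))
      exact ⟨g * n, L.mul_mem hg (hx hn), Or.inr (by simp [Equiv.Perm.mul_apply, h'])⟩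
    · obtain ⟨n, hn, h'⟩ := ty x hxy.symm (g⁻¹ w) (adjinv g hg _ _ (h ▸ hvw))
      exact ⟨g * n, L.mul_mem hg (hy hn), Or.inl (by simp [Equiv.Perm.mul_apply, h'])⟩
  have all : ∀ v w, (p : Δ.Walk v w) → (∃ g ∈ L, g x = v ∨ g y = v) →
      (∃ g ∈ L, g x = w ∨ g y = w) := by
    intro v w p
    induction p with
    | nil => exact id
    | cons h q ih => exact fun hh => ih (step _ _ h hh)
  intro s hs
  ext w
  obtain ⟨p⟩ := hconn.preconnected x w
  obtain ⟨g, hg, h⟩ := all x w p ⟨1, L.one_mem, Or.inl rfl⟩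
  have hs' : g⁻¹ * s * g ∈ S := by
    have := ((L.inv_mem hg).2 s).1 hs
    simpa using this
  rcases h with h | h
  · have := hSx _ hs'
    simp only [Equiv.Perm.mul_apply, h] at this
    rw [Equiv.Perm.inv_eq_iff_eq] at this
    simp [this, h]
  · have := hSy _ hs'
    simp only [Equiv.Perm.mul_apply, h] at this
    rw [Equiv.Perm.inv_eq_iff_eq] at this
    simp [this, h]

theorem conj_sSup {𝒮 : Set (Subgroup (Equiv.Perm V))} {g : Equiv.Perm V}
    (h : ∀ K ∈ 𝒮, K.map (MulAut.conj g).toMonoidHom ∈ 𝒮) :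
    ∀ k ∈ sSup 𝒮, g * k * g⁻¹ ∈ sSup 𝒮 := by
  have : sSup 𝒮 ≤ (sSup 𝒮).comap (MulAut.conj g).toMonoidHom := by
    apply sSup_le
    intro K hK
    rw [← Subgroup.map_le_iff_le_comap]
    exact le_sSup (h K hK)
  intro k hk
  simpa using this hk

theorem mem_map_conj {K : Subgroup (Equiv.Perm V)} {g k : Equiv.Perm V} :
    k ∈ K.map (MulAut.conj g).toMonoidHom ↔ g⁻¹ * k * g ∈ K := by
  constructor
  · rintro ⟨a, ha, rfl⟩
    simpa [mul_assoc] using ha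
  · intro h
    exact ⟨_, h, by simp [mul_assoc]⟩

theorem normalIn_map {K A N : Subgroup (Equiv.Perm V)} (hA : normalIn A N) (hK : normalIn K A)
    {g : Equiv.Perm V} (hg : g ∈ N) : normalIn (K.map (MulAut.conj g).toMonoidHom) A := by
  refine ⟨?_, fun h hh k hk => ?_⟩
  · rintro _ ⟨a, ha, rfl⟩
    simpa using hA.2 g hg a (hK.1 ha)
  · rw [mem_map_conj] at hk ⊢
    have := hK.2 _ (hA.inv hg hh) _ hk
    simpa [mul_assoc] using this

theorem normalIn_Op_of {p : ℕ} {A N : Subgroup (Equiv.Perm V)} (hA : normalIn A N) :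
    normalIn (Op p A) N := by
  refine ⟨sSup_le fun K hK => hK.1.1.trans hA.1, fun g hg => ?_⟩
  exact conj_sSup fun K hK => ⟨normalIn_map hA hK.1 hg, hK.2.map _⟩

theorem normalIn_self (H : Subgroup (Equiv.Perm V)) : normalIn H H :=
  ⟨le_rfl, fun h hh k hk => H.mul_mem (H.mul_mem hh hk) (H.inv_mem hh)⟩

theorem normalIn_Op (p : ℕ) (H : Subgroup (Equiv.Perm V)) : normalIn (Op p H) H :=
  normalIn_Op_of (normalIn_self H)

theorem normalIn_bot (H : Subgroup (Equiv.Perm V)) : normalIn ⊥ H :=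
  ⟨bot_le, fun h hh k hk => by
    rw [Subgroup.mem_bot] at hk ⊢
    simp [hk]⟩

theorem normalIn_sup {K L H : Subgroup (Equiv.Perm V)} (hK : normalIn K H) (hL : normalIn L H) :
    normalIn (K ⊔ L) H := by
  refine ⟨sup_le hK.1 hL.1, fun g hg => ?_⟩
  have : K ⊔ L ≤ (K ⊔ L).comap (MulAut.conj g).toMonoidHom := by
    apply sup_le
    · intro k hk
      exact (le_sup_left : K ≤ K ⊔ L) (by simpa using hK.2 g hg k hk)
    · intro k hk
      exact (le_sup_right : L ≤ K ⊔ L) (by simpa using hL.2 g hg k hk)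
  intro k hk
  simpa using this hk

theorem normalIn_le_normalizer {K H : Subgroup (Equiv.Perm V)} (hK : normalIn K H) :
    H ≤ Subgroup.normalizer (K : Set (Equiv.Perm V)) :=
  le_setNorm (S := (K : Set (Equiv.Perm V))) hK.2

theorem isPGroup_Op [Finite V] (p : ℕ) [Fact p.Prime] (H : Subgroup (Equiv.Perm V)) :
    IsPGroup p (Op p H) := by
  have hfin : Set.Finite {K : Subgroup (Equiv.Perm V) | normalIn K H ∧ IsPGroup p K} :=
    Set.toFinite _
  obtain ⟨M, hM⟩ := hfin.exists_maximal ⟨⊥, normalIn_bot H, IsPGroup.of_bot⟩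
  have : Op p H = M := by
    apply le_antisymm
    · apply sSup_le
      intro K hK
      have h2 : K ⊔ M ∈ {K : Subgroup (Equiv.Perm V) | normalIn K H ∧ IsPGroup p K} :=
        ⟨normalIn_sup hK.1 hM.1.1, IsPGroup.to_sup_of_normal_right' hK.2 hM.1.2
          (hK.1.1.trans (normalIn_le_normalizer hM.1.1))⟩
      exact le_sup_left.trans (hM.2 h2 le_sup_right)
    · exact le_sSup hM.1
  rw [this]
  exact hM.1.2

theorem le_Op {p : ℕ} {K H : Subgroup (Equiv.Perm V)} (h : normalIn K H) (hp : IsPGroup p K) :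
    K ≤ Op p H := le_sSup ⟨h, hp⟩

theorem Op_le_Op [Finite V] {p : ℕ} [Fact p.Prime] {A H : Subgroup (Equiv.Perm V)}
    (h : normalIn A H) : Op p A ≤ Op p H :=
  le_Op (normalIn_Op_of h) (isPGroup_Op p A)

/-- all `O_p(H)` are trivial -/
def OpT (H : Subgroup (Equiv.Perm V)) : Prop := ∀ p : ℕ, p.Prime → Op p H = ⊥

theorem OpT.of_normalIn [Finite V] {A H : Subgroup (Equiv.Perm V)} (h : normalIn A H)
    (hH : OpT H) : OpT A := by
  intro p hp
  have := Fact.mk hp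
  rw [eq_bot_iff, ← hH p hp]
  exact Op_le_Op h

theorem abelian_bot [Finite V] {Z A : Subgroup (Equiv.Perm V)} (hA : OpT A) (hZ : normalIn Z A)
    (hc : ∀ a ∈ Z, ∀ b ∈ Z, a * b = b * a) : Z = ⊥ := by
  by_contra hne
  obtain ⟨z, hz, hz1⟩ := (Subgroup.ne_bot_iff_exists_ne_one).1 hne |>.elim
    fun a ha => (⟨a.1, a.2, fun h => ha (Subtype.ext h)⟩ : ∃ z, z ∈ Z ∧ z ≠ 1)
  have ho : orderOf z ≠ 1 := by rwa [Ne, orderOf_eq_one_iff]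
  obtain ⟨p, hp, hdvd⟩ := Nat.exists_prime_and_dvd ho
  let P : Subgroup (Equiv.Perm V) :=
    { carrier := {a | a ∈ Z ∧ a ^ p = 1}
      one_mem' := ⟨Z.one_mem, one_pow _⟩
      mul_mem' := by
        rintro a b ⟨ha, ha'⟩ ⟨hb, hb'⟩
        refine ⟨Z.mul_mem ha hb, ?_⟩
        rw [(show Commute a b from hc a ha b hb).mul_pow, ha', hb', one_mul]
      inv_mem' := by
        rintro a ⟨ha, ha'⟩
        exact ⟨Z.inv_mem ha, by rw [inv_pow, ha', inv_one]⟩ }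
  have hP : normalIn P A := by
    refine ⟨fun a ha => hZ.1 ha.1, fun g hg a ha => ⟨hZ.2 g hg a ha.1, ?_⟩⟩
    rw [conj_pow, ha.2]; simp
  have hPp : IsPGroup p P := by
    rintro ⟨a, ha⟩
    exact ⟨1, Subtype.ext (by simpa using ha.2)⟩
  have hbot : P ≤ ⊥ := (le_Op hP hPp).trans (hA p hp).le
  have hmem : z ^ (orderOf z / p) ∈ P := by
    refine ⟨Z.pow_mem hz _, ?_⟩
    rw [← pow_mul, Nat.div_mul_cancel hdvd, pow_orderOf_eq_one]
  have h1 := Subgroup.mem_bot.1 (hbot hmem)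
  have h2 := orderOf_dvd_of_pow_eq_one h1
  have hpos := orderOf_pos z
  have h3 : orderOf z / p < orderOf z := Nat.div_lt_self hpos hp.one_lt
  have h4 : 0 < orderOf z / p := Nat.div_pos (Nat.le_of_dvd hpos hdvd) hp.pos
  exact absurd (Nat.le_of_dvd h4 h2) (by omega)

/-- centraliser of `K` in `H` -/
def cent (H K : Subgroup (Equiv.Perm V)) : Subgroup (Equiv.Perm V) :=
  H ⊓ Subgroup.centralizer (K : Set (Equiv.Perm V))

theorem mem_cent {H K : Subgroup (Equiv.Perm V)} {g : Equiv.Perm V} :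
    g ∈ cent H K ↔ g ∈ H ∧ ∀ k ∈ K, k * g = g * k := by
  simp [cent, Subgroup.mem_inf, Subgroup.mem_centralizer_iff]

theorem normalIn_cent {A K N : Subgroup (Equiv.Perm V)} (hA : normalIn A N)
    (hK : ∀ g ∈ N, ∀ k ∈ K, g * k * g⁻¹ ∈ K) : normalIn (cent A K) N := by
  refine ⟨inf_le_left.trans hA.1, fun g hg c hc => ?_⟩
  rw [mem_cent] at hc ⊢
  refine ⟨hA.2 g hg c hc.1, fun k hk => ?_⟩
  have h1 := hK g⁻¹ (N.inv_mem hg) k hk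
  have h2 := hc.2 _ h1
  simp only [inv_inv] at h2
  calc k * (g * c * g⁻¹) = g * (g⁻¹ * k * g * c) * g⁻¹ := by group
    _ = g * (c * (g⁻¹ * k * g)) * g⁻¹ := by rw [h2]
    _ = _ := by group

/-- Two normal subgroups with trivial intersection commute. -/
theorem comm_of_inf {K L H : Subgroup (Equiv.Perm V)} (hK : normalIn K H) (hL : normalIn L H)
    (h : K ⊓ L = ⊥) : ∀ k ∈ K, ∀ l ∈ L, k * l = l * k := by
  intro k hk l hl
  have h1 : k * l * k⁻¹ * l⁻¹ ∈ K ⊓ L := by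
    refine ⟨?_, L.mul_mem (hL.2 k (hK.1 hk) l hl) (L.inv_mem hl)⟩
    have := K.mul_mem hk (hK.2 l (hL.1 hl) _ (K.inv_mem hk))
    simpa [mul_assoc] using this
  rw [h, Subgroup.mem_bot] at h1
  rw [mul_inv_eq_one, mul_inv_eq_iff_eq_mul] at h1
  exact h1

/-- minimal normal subgroups -/
def minN (M H : Subgroup (Equiv.Perm V)) : Prop :=
  normalIn M H ∧ M ≠ ⊥ ∧ ∀ K, normalIn K H → K ≤ M → K = ⊥ ∨ K = M

/-- the socle -/
def soc (H : Subgroup (Equiv.Perm V)) : Subgroup (Equiv.Perm V) := sSup {M | minN M H}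

theorem exists_minN [Finite V] {K H : Subgroup (Equiv.Perm V)} (h : normalIn K H) (hne : K ≠ ⊥) :
    ∃ M, minN M H ∧ M ≤ K := by
  have hfin : Set.Finite {M : Subgroup (Equiv.Perm V) | normalIn M H ∧ M ≠ ⊥ ∧ M ≤ K} :=
    Set.toFinite _
  obtain ⟨M, hM⟩ := hfin.exists_minimal ⟨K, h, hne, le_rfl⟩
  refine ⟨M, ⟨hM.1.1, hM.1.2.1, fun L hL hLM => ?_⟩, hM.1.2.2⟩
  by_cases hb : L = ⊥
  · exact Or.inl hb
  · exact Or.inr (le_antisymm hLM (hM.2 ⟨hL, hb, hLM.trans hM.1.2.2⟩ hLM))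

theorem map_conj_inv (K : Subgroup (Equiv.Perm V)) (g : Equiv.Perm V) :
    (K.map (MulAut.conj g⁻¹).toMonoidHom).map (MulAut.conj g).toMonoidHom = K := by
  ext k
  rw [mem_map_conj, mem_map_conj]
  simp [mul_assoc]

theorem normalIn_soc_of {A N : Subgroup (Equiv.Perm V)} (hA : normalIn A N) :
    normalIn (soc A) N := by
  refine ⟨sSup_le fun K hK => hK.1.1.trans hA.1, fun g hg => ?_⟩
  refine conj_sSup fun K hK => ⟨normalIn_map hA hK.1 hg, ?_, fun L hL hLK => ?_⟩
  · intro h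
    exact hK.2.1 ((Subgroup.map_eq_bot_iff_of_injective _ (MulAut.conj g).injective).1 h)
  · have h1 := normalIn_map hA hL (N.inv_mem hg)
    have h2 : L.map (MulAut.conj g⁻¹).toMonoidHom ≤ K := by
      intro k hk
      rw [mem_map_conj] at hk
      have := hLK hk
      rw [mem_map_conj] at this
      simpa [mul_assoc] using this
    rcases hK.2.2 _ h1 h2 with h | h
    · left
      exact (Subgroup.map_eq_bot_iff_of_injective _ (MulAut.conj g⁻¹).injective).1 h
    · right
      rw [← h, map_conj_inv]

theorem minN.le {M K H : Subgroup (Equiv.Perm V)} (hM : minN M H) (hK : normalIn K H)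
    (h : M ⊓ K ≠ ⊥) : M ≤ K := by
  rcases hM.2.2 _ (hM.1.inf hK) inf_le_left with h' | h'
  · exact absurd h' h
  · rw [← h']; exact inf_le_right

theorem soc_eq [Finite V] {A D : Subgroup (Equiv.Perm V)} (hA : OpT A) (hD : normalIn D A)
    (hC : cent A D = ⊥) : soc A = soc D := by
  have hle : ∀ M, minN M A → M ≤ D := by
    intro M hM
    apply hM.le hD
    intro h
    apply hM.2.1
    rw [eq_bot_iff, ← hC]
    intro m hm
    exact mem_cent.2 ⟨hM.1.1 hm, fun k hk => (comm_of_inf hM.1 hD h m hm k hk).symm⟩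
  have hAD : soc A ≤ D := sSup_le hle
  apply le_antisymm
  · apply sSup_le
    intro M hM
    apply hM.le (normalIn_soc_of hD)
    intro h
    obtain ⟨N, hN, hNM⟩ := exists_minN (hM.1.mono hD.1 (hle M hM)) hM.2.1
    apply hN.2.1
    rw [eq_bot_iff, ← h]
    exact le_inf hNM (le_sSup hN)
  · apply sSup_le
    intro N hN
    have hsA : normalIn (soc A) A := normalIn_soc_of (normalIn_self A)
    have hsD : normalIn (soc A) D := hsA.mono hD.1 hAD
    apply hN.le hsD
    intro h
    have hc : cent A (soc A) = ⊥ := by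
      by_contra hne
      obtain ⟨M, hM, hMc⟩ := exists_minN (normalIn_cent (normalIn_self A) hsA.2) hne
      apply hM.2.1
      apply abelian_bot hA hM.1
      intro a ha b hb
      exact (mem_cent.1 (hMc hb)).2 a (le_sSup (a := M) hM ha)
    apply hN.2.1
    rw [eq_bot_iff, ← hc]
    intro n hn
    exact mem_cent.2 ⟨hD.1 (hN.1.1 hn), fun k hk => (comm_of_inf hN.1 hsD h n hn k hk).symm⟩

theorem soc_bot [Finite V] {D : Subgroup (Equiv.Perm V)} (h : soc D = ⊥) : D = ⊥ := by
  by_contra hne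
  obtain ⟨M, hM, -⟩ := exists_minN (normalIn_self D) hne
  exact hM.2.1 (eq_bot_iff.2 (h ▸ le_sSup hM))

/-- the case with trivial Fitting subgroup -/
theorem soc_eq_soc [Finite V] {A B H : Subgroup (Equiv.Perm V)} (hH : OpT H) (hA : normalIn A H)
    (hB : normalIn B H) (cA : cent H A ≤ A) (cB : cent H B ≤ B) : soc A = soc B ∧
      soc A = soc (A ⊓ B) := by
  have triv : ∀ A, normalIn A H → cent H A ≤ A → cent H A = ⊥ := by
    intro A hA cA
    apply abelian_bot hH (normalIn_cent (normalIn_self H) hA.2)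
    intro a ha b hb
    exact (mem_cent.1 hb).2 a (cA ha)
  have main : ∀ A B, normalIn A H → normalIn B H → cent H B ≤ B → soc A = soc (A ⊓ B) := by
    intro A B hA hB cB
    have hD := hA.inf hB
    apply soc_eq (OpT.of_normalIn hA hH) (hD.mono hA.1 inf_le_left)
    have hC := normalIn_cent hA hD.2
    have h1 : cent A (A ⊓ B) ⊓ B = ⊥ := by
      apply abelian_bot hH (hC.inf hB)
      intro a ha b hb
      exact (mem_cent.1 hb.1).2 a ⟨(mem_cent.1 ha.1).1, ha.2⟩
    rw [eq_bot_iff, ← triv B hB cB]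
    intro c hc
    exact mem_cent.2 ⟨hC.1 hc, fun k hk => (comm_of_inf hC hB h1 c hc k hk).symm⟩
  have h1 := main A B hA hB cB
  have h2 := main B A hB hA cA
  rw [inf_comm] at h2
  exact ⟨h1.trans h2.symm, h1⟩

theorem conj_coprime {p : ℕ} [Fact p.Prime] {R Q : Subgroup (Equiv.Perm V)}
    (hQ : IsPGroup p Q) (hn : ∀ q ∈ Q, ∀ r ∈ R, q * r * q⁻¹ ∈ R) {q r : Equiv.Perm V}
    (hq : q ∈ Q) (hr : r ∈ R) (ho : (orderOf (q * r)).Coprime p) : q * r ∈ R := by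
  have hpow : ∀ n : ℕ, (q * r) ^ n * (q ^ n)⁻¹ ∈ R := by
    intro n
    induction n with
    | zero => simp
    | succ n ih =>
      have h1 := hn (q ^ (n + 1)) (Q.pow_mem hq _) r hr
      have h2 := R.mul_mem ih h1
      have : (q * r) ^ n * (q ^ n)⁻¹ * (q ^ (n + 1) * r * (q ^ (n + 1))⁻¹)
          = (q * r) ^ (n + 1) * (q ^ (n + 1))⁻¹ := by
        rw [pow_succ q n, pow_succ (q * r) n]; group
      rwa [this] at h2
  obtain ⟨k, hk⟩ := hQ ⟨q, hq⟩
  have hk' : q ^ p ^ k = 1 := by simpa using congrArg Subtype.val hk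
  have h3 := hpow (p ^ k)
  rw [hk'] at h3
  simp only [inv_one, mul_one] at h3
  have hc : (orderOf (q * r)).Coprime (p ^ k) := Nat.Coprime.pow_right k ho
  obtain ⟨m, hm⟩ := exists_pow_eq_self_of_coprime hc.symm
  rw [← hm]
  exact R.pow_mem h3 m

theorem isPGroup_of_coprime [Finite V] {p : ℕ} [hp : Fact p.Prime] {R : Subgroup (Equiv.Perm V)}
    (h : ∀ r ∈ R, (orderOf r).Coprime p → r = 1) : IsPGroup p R := by
  rintro ⟨r, hr⟩
  have hpos := orderOf_pos r
  obtain ⟨k, m, hm, hkm⟩ := Nat.exists_eq_pow_mul_and_not_dvd hpos.ne' p hp.out.ne_one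
  refine ⟨k, Subtype.ext ?_⟩
  have h1 : orderOf (r ^ p ^ k) = m := by
    rw [orderOf_pow_of_dvd (pow_ne_zero _ hp.out.ne_zero) ⟨m, hkm⟩, hkm]
    exact Nat.mul_div_cancel_left _ (pow_pos hp.out.pos _)
  have := h _ (R.pow_mem hr (p ^ k)) (by
    rw [h1]; exact ((Nat.Prime.coprime_iff_not_dvd hp.out).2 hm).symm)
  simpa using this

theorem fix_spread {Δ : SimpleGraph V} {G : Subgroup (Equiv.Perm V)} (hconn : Δ.Connected)
    (hG : isAut Δ G) {x y : V} (hxy : Δ.Adj x y) (S : Set (Equiv.Perm V))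
    (hS : ∀ s ∈ S, s ∈ ball Δ G y 1) {N : Subgroup (Equiv.Perm V)} (hN : N ≤ vstab G x)
    (tx : transOn Δ N x) (ix : ∀ g ∈ N, ∀ s ∈ S, g * s * g⁻¹ ∈ S) :
    ∀ s ∈ S, s ∈ ball Δ G x 2 := by
  intro s hs
  apply ball_succ hconn hxy le_rfl
  intro z hz
  obtain ⟨n, hn, rfl⟩ := tx y hxy z hz
  have h1 := hS _ (ix n⁻¹ (N.inv_mem hn) s hs)
  have h2 := conj_ball hG hconn ((mem_vstab' _ _ _).1 (hN hn)).1 h1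
  simpa [mul_assoc] using h2

theorem ball_two_le {Δ : SimpleGraph V} {G : Subgroup (Equiv.Perm V)} (hconn : Δ.Connected)
    {x y : V} (hxy : Δ.Adj x y) : ball Δ G x 2 ≤ ball Δ G x 1 ⊓ ball Δ G y 1 :=
  le_inf (ball_anti _ _ _ (by norm_num)) (ball_adj hconn hxy 1)

theorem Ep_le {Δ : SimpleGraph V} {G : Subgroup (Equiv.Perm V)} (p : ℕ) (x : V) :
    Ep Δ G p x ≤ vstab G x :=
  iSup₂_le fun _ _ => (normalIn_Op p _).1.trans inf_le_left

theorem Op_le_Ep {Δ : SimpleGraph V} {G : Subgroup (Equiv.Perm V)} (p : ℕ) {x y : V}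
    (hxy : Δ.Adj x y) : Op p (vstab G x ⊓ vstab G y) ≤ Ep Δ G p x :=
  le_iSup₂_of_le (f := fun z (_ : z ∈ Δ.neighborSet x) => Op p (vstab G x ⊓ vstab G z)) y hxy le_rfl

theorem ball_normal_arc {Δ : SimpleGraph V} {G : Subgroup (Equiv.Perm V)} (hconn : Δ.Connected)
    (hG : isAut Δ G) {x y : V} (hxy : Δ.Adj x y) {i : ℕ} (hi : 1 ≤ i) :
    normalIn (ball Δ G x i) (vstab G x ⊓ vstab G y) :=
  (normalIn_ball hG hconn x i).mono inf_le_left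
    (le_inf (ball_le_vstab x i) (ball_le_vstab_adj hxy hi))

/-- elements acting trivially on `A/Q` -/
def trivMod (N A Q : Subgroup (Equiv.Perm V)) (hA : normalIn A N) (hQ : normalIn Q N) :
    Subgroup (Equiv.Perm V) where
  carrier := {g | g ∈ N ∧ ∀ a ∈ A, g * a * g⁻¹ * a⁻¹ ∈ Q}
  one_mem' := ⟨N.one_mem, fun a _ => by simp⟩
  mul_mem' := by
    rintro g h ⟨hg, hg'⟩ ⟨hh, hh'⟩
    refine ⟨N.mul_mem hg hh, fun a ha => ?_⟩
    have h1 := Q.mul_mem (hQ.2 g hg _ (hh' a ha)) (hg' a ha)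
    convert h1 using 1
    group
  inv_mem' := by
    rintro g ⟨hg, hg'⟩
    refine ⟨N.inv_mem hg, fun a ha => ?_⟩
    have h1 := Q.inv_mem (hg' _ (hA.inv hg ha))
    convert h1 using 1
    group

theorem Ep_comm [Finite V] {Δ : SimpleGraph V} {G : Subgroup (Equiv.Perm V)} (hconn : Δ.Connected)
    (hG : isAut Δ G) (p : ℕ) [Fact p.Prime] (x : V) {g a : Equiv.Perm V} (hg : g ∈ Ep Δ G p x)
    (ha : a ∈ ball Δ G x 1) : g * a * g⁻¹ * a⁻¹ ∈ Op p (ball Δ G x 1) := by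
  have hA := normalIn_ball hG hconn x 1
  have hle : Ep Δ G p x ≤ trivMod (vstab G x) (ball Δ G x 1) (Op p (ball Δ G x 1)) hA
      (normalIn_Op_of hA) := by
    refine iSup₂_le fun z hz g hg => ⟨(normalIn_Op p _).1 hg |>.1, fun a ha => ?_⟩
    have hO := normalIn_Op p (vstab G x ⊓ vstab G z)
    have hAz := ball_normal_arc hconn hG hz le_rfl
    have h1 : Op p (vstab G x ⊓ vstab G z) ⊓ ball Δ G x 1 ≤ Op p (ball Δ G x 1) :=
      le_Op ((hO.inf hAz).mono hAz.1 inf_le_right) ((isPGroup_Op p _).to_le inf_le_left)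
    apply h1
    refine ⟨?_, Subgroup.mul_mem _ (hAz.2 g (hO.1 hg) a ha) (Subgroup.inv_mem _ ha)⟩
    have := Subgroup.mul_mem _ hg (hO.2 a (hAz.1 ha) _ (Subgroup.inv_mem _ hg))
    simpa [mul_assoc] using this
  exact (hle hg).2 a ha

/-- elements of order prime to p of `R` -/
def pprime (p : ℕ) (R : Subgroup (Equiv.Perm V)) : Set (Equiv.Perm V) :=
  {r | r ∈ R ∧ (orderOf r).Coprime p}

theorem orderOf_conj' (g r : Equiv.Perm V) : orderOf (g * r * g⁻¹) = orderOf r := by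
  have := orderOf_injective (MulAut.conj g).toMonoidHom (MulAut.conj g).injective r
  simpa using this

theorem pprime_conj {p : ℕ} {R N : Subgroup (Equiv.Perm V)} (h : normalIn R N) :
    ∀ g ∈ N, ∀ s ∈ pprime p R, g * s * g⁻¹ ∈ pprime p R :=
  fun g hg s hs => ⟨h.2 g hg s hs.1, by rw [orderOf_conj']; exact hs.2⟩

theorem pprime_Ep [Finite V] {Δ : SimpleGraph V} {G : Subgroup (Equiv.Perm V)}
    (hconn : Δ.Connected) (hG : isAut Δ G) (p : ℕ) [Fact p.Prime] {x y : V} (hxy : Δ.Adj x y)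
    {R : Subgroup (Equiv.Perm V)} (hR : R ≤ ball Δ G x 1)
    (hRn : normalIn R (vstab G x ⊓ vstab G y)) :
    ∀ g ∈ Ep Δ G p x, ∀ s ∈ pprime p R, g * s * g⁻¹ ∈ pprime p R := by
  intro g hg s hs
  have ho : (orderOf (g * s * g⁻¹)).Coprime p := by rw [orderOf_conj']; exact hs.2
  refine ⟨?_, ho⟩
  have hAxy := ball_normal_arc hconn hG hxy le_rfl
  have h1 := Ep_comm hconn hG p x hg (hR hs.1)
  have h2 : g * s * g⁻¹ = g * s * g⁻¹ * s⁻¹ * s := by group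
  rw [h2] at ho ⊢
  exact conj_coprime (isPGroup_Op p (ball Δ G x 1))
    (fun q hq r hr => hRn.2 q (hAxy.1 ((normalIn_Op p _).1 hq)) r hr) h1 hs.1 ho

theorem caseA [Finite V] {Δ : SimpleGraph V} {G : Subgroup (Equiv.Perm V)} (hconn : Δ.Connected)
    (hG : isAut Δ G) (hstar : StarHyp Δ G) {x y : V} (hxy : Δ.Adj x y)
    (ht : transOn Δ (locCent Δ G x) x) :
    ball Δ G x 1 ⊓ ball Δ G y 1 = ball Δ G x 2 ∧ ball Δ G y 2 = ball Δ G y 3 ∧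
      ∃ p : ℕ, p.Prime ∧ IsPGroup p ↥(ball Δ G y 2) := by
  have hinv : ∀ R : Subgroup (Equiv.Perm V), R ≤ ball Δ G x 1 →
      ∀ g ∈ locCent Δ G x, ∀ s ∈ (R : Set (Equiv.Perm V)), g * s * g⁻¹ ∈ (R : Set _) := by
    intro R hR g hg s hs
    have := (Subgroup.mem_centralizer_iff.1 hg.2) s (hR hs)
    rw [← this]
    simpa using hs
  have h2 : ball Δ G y 2 = ⊥ := by
    rw [eq_bot_iff]
    have hle : ball Δ G y 2 ≤ ball Δ G x 1 := ball_adj hconn hxy.symm 1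
    exact key hconn hG hxy (ball Δ G y 2 : Set (Equiv.Perm V))
      (fun s hs => ((mem_vstab' _ _ _).1 (ball_le_vstab x 1 (hle hs))).2)
      (fun s hs => ((mem_vstab' _ _ _).1 (ball_le_vstab y 2 hs)).2)
      inf_le_left le_rfl ht (hstar y).1 (hinv _ hle) (normalIn_ball hG hconn y 2).2
  refine ⟨le_antisymm ?_ (ball_two_le hconn hxy), ?_, 2, Nat.prime_two, ?_⟩
  · exact fix_spread hconn hG hxy ((ball Δ G x 1 ⊓ ball Δ G y 1 : Subgroup (Equiv.Perm V)) : Set (Equiv.Perm V))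
      (fun s hs => hs.2) inf_le_left ht (hinv (ball Δ G x 1 ⊓ ball Δ G y 1) inf_le_left)
  · have h3 : ball Δ G y 3 ≤ ball Δ G y 2 := ball_anti _ _ _ (by norm_num)
    rw [h2] at h3 ⊢
    exact (le_bot_iff.1 h3).symm
  · rw [h2]; exact IsPGroup.of_bot

theorem Op_le_of_semireg {Δ : SimpleGraph V} {G : Subgroup (Equiv.Perm V)} (hconn : Δ.Connected)
    {p : ℕ} {x y : V} (hxy : Δ.Adj x y)
    (hs : semiregOn Δ (Ep Δ G p x) x) : Op p (vstab G x ⊓ vstab G y) ≤ ball Δ G x 1 := by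
  intro g hg
  have hg' := (normalIn_Op p _).1 hg
  exact mem_ball_one hconn hg'.1
    (hs g (Op_le_Ep p hxy hg) ⟨y, hxy, ((mem_vstab' _ _ _).1 hg'.2).2⟩)

theorem Op_eq_of_semireg [Finite V] {Δ : SimpleGraph V} {G : Subgroup (Equiv.Perm V)}
    (hconn : Δ.Connected) (hG : isAut Δ G) {p : ℕ} [Fact p.Prime] {x y : V} (hxy : Δ.Adj x y)
    (hs : semiregOn Δ (Ep Δ G p x) x) :
    Op p (vstab G x ⊓ vstab G y) = Op p (ball Δ G x 1) := by
  have hA := ball_normal_arc hconn hG hxy le_rfl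
  apply le_antisymm
  · exact le_Op ((normalIn_Op p _).mono hA.1 (Op_le_of_semireg hconn hxy hs)) (isPGroup_Op p _)
  · exact Op_le_Op hA

theorem caseE [Finite V] {Δ : SimpleGraph V} {G : Subgroup (Equiv.Perm V)} (hconn : Δ.Connected)
    (hG : isAut Δ G) (hstar : StarHyp Δ G) {p : ℕ} (hp : p.Prime) {x y : V} (hxy : Δ.Adj x y)
    (ht : transOn Δ (Ep Δ G p x) x) :
    (∃ p : ℕ, p.Prime ∧ IsPGroup p ↥(ball Δ G x 1 ⊓ ball Δ G y 1)) ∨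
    (ball Δ G x 1 ⊓ ball Δ G y 1 = ball Δ G x 2 ∧ ball Δ G y 2 = ball Δ G y 3 ∧
      ∃ p : ℕ, p.Prime ∧ IsPGroup p ↥(ball Δ G y 2)) := by
  have := Fact.mk hp
  have hAx := ball_normal_arc hconn hG hxy le_rfl
  have hAy := ball_normal_arc hconn hG hxy.symm le_rfl
  have hD := hAx.inf (inf_comm (vstab G x) (vstab G y) ▸ hAy)
  have hD' := inf_comm (vstab G x) (vstab G y) ▸ hD
  rcases (hstar y).2.2 p hp with hy | hy
  · left
    refine ⟨p, hp, isPGroup_of_coprime fun r hr ho => ?_⟩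
    exact key hconn hG hxy (pprime p (ball Δ G x 1 ⊓ ball Δ G y 1))
      (fun s hs => ((mem_vstab' _ _ _).1 (hD.1 hs.1).1).2)
      (fun s hs => ((mem_vstab' _ _ _).1 (hD.1 hs.1).2).2)
      (Ep_le p x) (Ep_le p y) ht hy (pprime_Ep hconn hG p hxy inf_le_left hD)
      (pprime_Ep hconn hG p hxy.symm inf_le_right hD') r ⟨hr, ho⟩
  · right
    have hle : ball Δ G y 2 ≤ ball Δ G x 1 := ball_adj hconn hxy.symm 1
    have hBy : normalIn (ball Δ G y 2) (vstab G x ⊓ vstab G y) :=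
      inf_comm (vstab G x) (vstab G y) ▸ ball_normal_arc hconn hG hxy.symm (i := 2) (by norm_num)
    have hP : IsPGroup p ↥(ball Δ G y 2) := by
      refine isPGroup_of_coprime fun r hr ho => ?_
      exact key hconn hG hxy (pprime p (ball Δ G y 2))
        (fun s hs => ((mem_vstab' _ _ _).1 (hBy.1 hs.1).1).2)
        (fun s hs => ((mem_vstab' _ _ _).1 (hBy.1 hs.1).2).2)
        (Ep_le p x) le_rfl ht (hstar y).1 (pprime_Ep hconn hG p hxy hle hBy)
        (pprime_conj (normalIn_ball hG hconn y 2)) r ⟨hr, ho⟩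
    have hQ : Op p (ball Δ G x 1) ≤ ball Δ G x 1 ⊓ ball Δ G y 1 := by
      refine le_inf (normalIn_Op p _).1 ((Op_le_Op hAx).trans ?_)
      rw [inf_comm]
      exact Op_le_of_semireg hconn hxy.symm hy
    have hDle : ball Δ G x 1 ⊓ ball Δ G y 1 ≤ ball Δ G x 2 := by
      refine fix_spread hconn hG hxy ((ball Δ G x 1 ⊓ ball Δ G y 1 : Subgroup (Equiv.Perm V)) : Set (Equiv.Perm V))
        (fun s hs => hs.2) (Ep_le p x) ht (fun g hg s hs => ?_)
      have h1 := Subgroup.mul_mem _ (hQ (Ep_comm hconn hG p x hg hs.1)) hs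
      simpa using h1
    have h23 : ball Δ G y 2 ≤ ball Δ G x 2 :=
      (le_Op (hBy.mono hAx.1 hle) hP).trans (hQ.trans hDle)
    refine ⟨le_antisymm hDle (ball_two_le hconn hxy), le_antisymm ?_ ?_, p, hp, hP⟩
    · intro g hg
      apply ball_succ hconn hxy.symm (by norm_num)
      intro z hz
      obtain ⟨n, hn, rfl⟩ := (hstar y).1 x hxy.symm z hz
      have h1 := h23 ((normalIn_ball hG hconn y 2).inv hn hg)
      have h2 := conj_ball hG hconn ((mem_vstab' _ _ _).1 hn).1 h1
      simpa [mul_assoc] using h2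
    · exact ball_anti _ _ _ (by norm_num)

theorem caseT [Finite V] {Δ : SimpleGraph V} {G : Subgroup (Equiv.Perm V)} (hconn : Δ.Connected)
    (hG : isAut Δ G) (hstar : StarHyp Δ G) {x y : V} (hxy : Δ.Adj x y)
    (hx : semiregOn Δ (locCent Δ G x) x) (hy : semiregOn Δ (locCent Δ G y) y)
    (hT : OpT (vstab G x ⊓ vstab G y)) : ball Δ G x 1 ⊓ ball Δ G y 1 = ⊥ := by
  have hAx := ball_normal_arc hconn hG hxy le_rfl
  have hAy : normalIn (ball Δ G y 1) (vstab G x ⊓ vstab G y) :=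
    inf_comm (vstab G x) (vstab G y) ▸ ball_normal_arc hconn hG hxy.symm le_rfl
  obtain ⟨h1, h2⟩ := soc_eq_soc hT hAx hAy
    (fun g hg => mem_ball_one hconn hg.1.1
      (hx g ⟨hg.1.1, hg.2⟩ ⟨y, hxy, ((mem_vstab' _ _ _).1 hg.1.2).2⟩))
    (fun g hg => mem_ball_one hconn hg.1.2
      (hy g ⟨hg.1.2, hg.2⟩ ⟨x, hxy.symm, ((mem_vstab' _ _ _).1 hg.1.1).2⟩))
  apply soc_bot
  rw [← h2, eq_bot_iff]
  have hs := normalIn_soc_of hAx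
  refine key hconn hG hxy (soc (ball Δ G x 1) : Set (Equiv.Perm V))
    (fun s hs' => ((mem_vstab' _ _ _).1 (hs.1 hs').1).2)
    (fun s hs' => ((mem_vstab' _ _ _).1 (hs.1 hs').2).2)
    le_rfl le_rfl (hstar x).1 (hstar y).1 (normalIn_soc_of (normalIn_ball hG hconn x 1)).2 ?_
  rw [h1]
  exact (normalIn_soc_of (normalIn_ball hG hconn y 1)).2

end helpers

theorem stmt11 {V : Type*} [Fintype V] (Δ : SimpleGraph V) (G : Subgroup (Equiv.Perm V))
    (hconn : Δ.Connected) (hG : isAut Δ G) (hstar : StarHyp Δ G)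
    {x y : V} (hxy : Δ.Adj x y) :
    (∃ p : ℕ, p.Prime ∧ IsPGroup p ↥(ball Δ G x 1 ⊓ ball Δ G y 1)) ∨
    (ball Δ G x 1 ⊓ ball Δ G y 1 = ball Δ G x 2 ∧ ball Δ G y 2 = ball Δ G y 3 ∧
      ∃ p : ℕ, p.Prime ∧ IsPGroup p ↥(ball Δ G y 2)) ∨
    (ball Δ G x 1 ⊓ ball Δ G y 1 = ball Δ G y 2 ∧ ball Δ G x 2 = ball Δ G x 3 ∧
      ∃ p : ℕ, p.Prime ∧ IsPGroup p ↥(ball Δ G x 2)) := by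
  rcases (hstar x).2.1 with hx | hx
  · exact Or.inr (Or.inl (caseA hconn hG hstar hxy hx))
  rcases (hstar y).2.1 with hy | hy
  · have := caseA hconn hG hstar hxy.symm hy
    rw [inf_comm] at this
    exact Or.inr (Or.inr this)
  by_cases hT : OpT (vstab G x ⊓ vstab G y)
  · refine Or.inl ⟨2, Nat.prime_two, ?_⟩
    rw [caseT hconn hG hstar hxy hx hy hT]
    exact IsPGroup.of_bot
  simp only [OpT, not_forall] at hT
  obtain ⟨p, hp, hne⟩ := hT
  rcases (hstar x).2.2 p hp with ex | ex
  · rcases caseE hconn hG hstar hp hxy ex with h | h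
    · exact Or.inl h
    · exact Or.inr (Or.inl h)
  rcases (hstar y).2.2 p hp with ey | ey
  · have := caseE hconn hG hstar hp hxy.symm ey
    rw [inf_comm] at this
    rcases this with h | h
    · exact Or.inl h
    · exact Or.inr (Or.inr h)
  exfalso
  apply hne
  have := Fact.mk hp
  have h1 := Op_eq_of_semireg hconn hG hxy ex
  have h2 := Op_eq_of_semireg hconn hG hxy.symm ey
  rw [inf_comm] at h2
  have hO := normalIn_Op p (vstab G x ⊓ vstab G y)
  have nx := normalIn_Op_of (p := p) (normalIn_ball hG hconn x 1)
  have ny := normalIn_Op_of (p := p) (normalIn_ball hG hconn y 1)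
  rw [← h1] at nx
  rw [← h2] at ny
  rw [eq_bot_iff]
  exact key hconn hG hxy (Op p (vstab G x ⊓ vstab G y) : Set (Equiv.Perm V))
    (fun s hs => ((mem_vstab' _ _ _).1 (hO.1 hs).1).2)
    (fun s hs => ((mem_vstab' _ _ _).1 (hO.1 hs).2).2)
    le_rfl le_rfl (hstar x).1 (hstar y).1 nx.2 ny.2
end
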